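/- arXiv:2008.09925 — 5 statements merged into one kernel-verified Lean document; each statement's English description precedes it below -/
import Mathlib

section
/- Fix β ∈ ℝ and D < ∞. There exists a constant C = C(β, D) < ∞ such that for every N ≥ 1 and every finite simple graph G on vertex set {1,…,N} with no isolated vertices satisfying (1/N)·Σ_{u=1}^N d_u(G) ≤ D, one has E_{σ∼P^N_β}[ (L^N_σ(β))² ] ≤ C/N. -/
open Finset Filter

open scoped Classical

noncomputable section

/-- The set of occupied vertices of the configuration `σ` forms an independent set of `G`. -/
def isInd {N : ℕ} (G : SimpleGraph (Fin N)) (σ : Fin N → Bool) : Prop :=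
  ∀ u v : Fin N, G.Adj u v → ¬(σ u = true ∧ σ v = true)

/-- `c^N(σ)`: the number of occupied vertices of the configuration `σ`. -/
def cN {N : ℕ} (σ : Fin N → Bool) : ℕ := (univ.filter fun u => σ u = true).card

/-- `u^N(σ)`: the number of vertices `u` with `σ u = 0` all of whose neighbors also
have value `0`. -/
def uN {N : ℕ} (G : SimpleGraph (Fin N)) (σ : Fin N → Bool) : ℕ :=
  (univ.filter fun u : Fin N =>
    σ u = false ∧ ∀ v : Fin N, G.Adj u v → σ v = false).card

/-- The degree of the vertex `u` in `G`. -/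
def deg {N : ℕ} (G : SimpleGraph (Fin N)) (u : Fin N) : ℕ :=
  (univ.filter fun v => G.Adj u v).card

/-- Unnormalized weight of a configuration in the hardcore model with parameter `β`. -/
def hcWeight {N : ℕ} (G : SimpleGraph (Fin N)) (β : ℝ) (σ : Fin N → Bool) : ℝ :=
  if isInd G σ then Real.exp (β * cN σ) else 0

/-- Probability of the event `A` under the hardcore model `P^N_β` on `G`. -/
def hcProb {N : ℕ} (G : SimpleGraph (Fin N)) (β : ℝ) (A : (Fin N → Bool) → Prop) : ℝ :=
  (∑ σ : Fin N → Bool, if A σ then hcWeight G β σ else 0) /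
    ∑ σ : Fin N → Bool, hcWeight G β σ

/-- Expectation of `f` under the hardcore model `P^N_β` on `G`. -/
def hcExp {N : ℕ} (G : SimpleGraph (Fin N)) (β : ℝ) (f : (Fin N → Bool) → ℝ) : ℝ :=
  (∑ σ : Fin N → Bool, hcWeight G β σ * f σ) / ∑ σ : Fin N → Bool, hcWeight G β σ

/-- `L^N_σ(b)`: (1/N times) the derivative of the log pseudo-likelihood of the
hardcore model at `b`. -/
def LN {N : ℕ} (G : SimpleGraph (Fin N)) (σ : Fin N → Bool) (b : ℝ) : ℝ :=
  (1 / N : ℝ) * ((cN σ : ℝ) - (Real.exp b / (Real.exp b + 1)) * ((cN σ : ℝ) + (uN G σ : ℝ)))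

/-- The centered contribution of the vertex `u`. -/
def hcX {N : ℕ} (G : SimpleGraph (Fin N)) (p : ℝ) (u : Fin N) (σ : Fin N → Bool) : ℝ :=
  if ∀ v : Fin N, G.Adj u v → σ v = false then (if σ u = true then 1 else 0) - p else 0

lemma hcX_abs {N : ℕ} (G : SimpleGraph (Fin N)) (p : ℝ) (h0 : 0 ≤ p) (h1 : p ≤ 1)
    (u : Fin N) (σ : Fin N → Bool) : |hcX G p u σ| ≤ 1 := by
  unfold hcX
  rw [abs_le]
  split_ifs <;> constructor <;> linarith

lemma hcWeight_nonneg {N : ℕ} (G : SimpleGraph (Fin N)) (β : ℝ) (σ : Fin N → Bool) :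
    0 ≤ hcWeight G β σ := by
  unfold hcWeight
  split_ifs
  · positivity
  · exact le_rfl

lemma hcZ_pos {N : ℕ} (G : SimpleGraph (Fin N)) (β : ℝ) :
    0 < ∑ σ : Fin N → Bool, hcWeight G β σ := by
  apply Finset.sum_pos' (fun σ _ => hcWeight_nonneg G β σ)
  refine ⟨fun _ => false, mem_univ _, ?_⟩
  have : isInd G (fun _ => false) := by
    intro u v _
    simp
  unfold hcWeight
  rw [if_pos this]
  positivity

lemma cN_update {N : ℕ} (σ : Fin N → Bool) (u : Fin N) :
    cN (Function.update σ u true) = cN (Function.update σ u false) + 1 := by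
  unfold cN
  have h : (univ.filter fun v => Function.update σ u true v = true)
      = insert u (univ.filter fun v => Function.update σ u false v = true) := by
    ext v
    by_cases hv : v = u
    · subst hv; simp
    · simp [hv]
  rw [h, card_insert_of_notMem (by simp)]

lemma hcX_update_other {N : ℕ} (G : SimpleGraph (Fin N)) (p : ℝ) (u v : Fin N) (huv : u ≠ v)
    (hadj : ¬ G.Adj v u) (σ : Fin N → Bool) (b : Bool) :
    hcX G p v (Function.update σ u b) = hcX G p v σ := by
  unfold hcX
  have h : (∀ w : Fin N, G.Adj v w → Function.update σ u b w = false) ↔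
      (∀ w : Fin N, G.Adj v w → σ w = false) := by
    refine forall_congr' fun w => ?_
    by_cases hw : w = u
    · subst hw; simp [hadj]
    · simp [hw]
  simp only [h, Function.update_of_ne huv.symm]

lemma hcPair {N : ℕ} (G : SimpleGraph (Fin N)) (β : ℝ) (u : Fin N) (σ : Fin N → Bool) :
    hcWeight G β (Function.update σ u true) *
        hcX G (Real.exp β / (Real.exp β + 1)) u (Function.update σ u true)
      + hcWeight G β (Function.update σ u false) *
        hcX G (Real.exp β / (Real.exp β + 1)) u (Function.update σ u false) = 0 := by
  have hA : ∀ b : Bool, (∀ w : Fin N, G.Adj u w → Function.update σ u b w = false) ↔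
      (∀ w : Fin N, G.Adj u w → σ w = false) := by
    intro b
    refine forall_congr' fun w => ?_
    by_cases hw : w = u
    · subst hw; simp
    · simp [hw]
  unfold hcX
  simp only [hA, Function.update_self]
  by_cases h : ∀ w : Fin N, G.Adj u w → σ w = false
  · have hI : isInd G (Function.update σ u true) ↔ isInd G (Function.update σ u false) := by
      unfold isInd
      refine forall_congr' fun x => forall_congr' fun y => ?_
      by_cases hx : x = u
      · subst hx
        by_cases hy : y = x
        · subst hy; simp
        · simp only [Function.update_self, Function.update_of_ne hy]
          have := h y
          grind
      · by_cases hy : y = u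
        · subst hy
          simp only [Function.update_self, Function.update_of_ne hx]
          have := h x
          have := G.adj_comm x y
          grind
        · simp [hx, hy]
    unfold hcWeight
    rw [cN_update]
    simp only [hI, if_pos h]
    have he := Real.exp_pos β
    by_cases hJ : isInd G (Function.update σ u false)
    · rw [if_pos hJ, if_pos hJ, if_pos trivial, if_neg Bool.false_ne_true]
      push_cast
      rw [mul_add, Real.exp_add, mul_one]
      field_simp
      ring
    · simp [hJ]
  · simp [h]

lemma hcCov {N : ℕ} (G : SimpleGraph (Fin N)) (β : ℝ) (u v : Fin N) (huv : u ≠ v)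
    (hadj : ¬ G.Adj u v) :
    ∑ σ : Fin N → Bool, hcWeight G β σ * (hcX G (Real.exp β / (Real.exp β + 1)) u σ *
      hcX G (Real.exp β / (Real.exp β + 1)) v σ) = 0 := by
  have hadj' : ¬ G.Adj v u := fun h => hadj h.symm
  refine Finset.sum_involution (fun σ _ => Function.update σ u (!σ u)) ?_ ?_ ?_ ?_
  · intro σ _
    have hp := hcPair G β u σ
    rw [hcX_update_other G _ u v huv hadj', ← mul_assoc, ← mul_assoc, ← add_mul]
    cases hs : σ u
    · have : Function.update σ u false = σ := by rw [← hs]; simp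
      rw [this] at hp
      simp only [Bool.not_false]
      rw [add_comm, hp, zero_mul]
    · have : Function.update σ u true = σ := by rw [← hs]; simp
      rw [this] at hp
      simp only [Bool.not_true]
      rw [hp, zero_mul]
  · intro σ _ _ h
    have := congrFun h u
    simp at this
  · intro σ _
    exact mem_univ _
  · intro σ _
    simp

lemma hcLN {N : ℕ} (hN : 1 ≤ N) (G : SimpleGraph (Fin N)) (β : ℝ) (σ : Fin N → Bool)
    (hI : isInd G σ) :
    LN G σ β = (1 / N : ℝ) * ∑ u, hcX G (Real.exp β / (Real.exp β + 1)) u σ := by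
  unfold LN cN uN
  congr 1
  rw [card_filter, card_filter]
  push_cast
  rw [← sum_add_distrib, mul_sum, ← sum_sub_distrib]
  refine sum_congr rfl fun u _ => ?_
  unfold hcX
  cases hs : σ u
  · simp
    split_ifs <;> simp
  · have : ∀ v : Fin N, G.Adj u v → σ v = false := by
      intro v hv
      have := hI u v hv
      simpa [hs] using this
    rw [if_pos this]
    simp

/-- second moment bound for the derivative of the log pseudo-likelihood
at the true parameter, uniformly over graphs with no isolated vertices and average
degree at most `D`. -/
theorem stmt2 (β D : ℝ) :
    ∃ C : ℝ, ∀ N : ℕ, 1 ≤ N → ∀ G : SimpleGraph (Fin N),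
      (∀ u : Fin N, 0 < deg G u) →
      (1 / N : ℝ) * ∑ u : Fin N, (deg G u : ℝ) ≤ D →
      hcExp G β (fun σ => (LN G σ β) ^ 2) ≤ C / N := by
  refine ⟨1 + D, fun N hN G _ hD => ?_⟩
  have hNpos : (0 : ℝ) < N := by exact_mod_cast hN
  have hZ := hcZ_pos G β
  set p : ℝ := Real.exp β / (Real.exp β + 1) with hp
  have he := Real.exp_pos β
  have hp0 : 0 ≤ p := by positivity
  have hp1 : p ≤ 1 := by
    rw [hp, div_le_one (by positivity)]
    linarith
  unfold hcExp
  rw [div_le_iff₀ hZ]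
  set Z := ∑ σ : Fin N → Bool, hcWeight G β σ with hZdef
  have h1 : ∑ σ : Fin N → Bool, hcWeight G β σ * (LN G σ β) ^ 2
      = (1 / N : ℝ) ^ 2 * ∑ u : Fin N, ∑ v : Fin N, ∑ σ : Fin N → Bool,
        hcWeight G β σ * (hcX G p u σ * hcX G p v σ) := by
    have : ∀ σ : Fin N → Bool, hcWeight G β σ * (LN G σ β) ^ 2
        = (1 / N : ℝ) ^ 2 * ∑ u : Fin N, ∑ v : Fin N,
          hcWeight G β σ * (hcX G p u σ * hcX G p v σ) := by
      intro σ
      by_cases hI : isInd G σ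
      · rw [hcLN hN G β σ hI, mul_pow, sq (∑ u, _), sum_mul_sum]
        simp only [← mul_sum]
        ring
      · simp [hcWeight, hI]
    rw [sum_congr rfl fun σ _ => this σ, ← mul_sum]
    congr 1
    rw [sum_comm]
    refine sum_congr rfl fun u _ => ?_
    rw [sum_comm]
  have h2 : ∀ u v : Fin N, ∑ σ : Fin N → Bool, hcWeight G β σ * (hcX G p u σ * hcX G p v σ)
      ≤ (if u = v then Z else 0) + (if G.Adj u v then Z else 0) := by
    intro u v
    have hle : ∑ σ : Fin N → Bool, hcWeight G β σ * (hcX G p u σ * hcX G p v σ) ≤ Z := by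
      refine sum_le_sum fun σ _ => ?_
      refine mul_le_of_le_one_right (hcWeight_nonneg G β σ) ?_
      refine (le_abs_self _).trans ?_
      rw [abs_mul]
      exact mul_le_one₀ (hcX_abs G p hp0 hp1 u σ) (abs_nonneg _) (hcX_abs G p hp0 hp1 v σ)
    by_cases huv : u = v
    · subst huv
      simpa using hle
    · by_cases ha : G.Adj u v
      · simpa [huv, ha] using hle
      · rw [hcCov G β u v huv ha]
        simp [huv, ha]
  have h3 : ∑ u : Fin N, ∑ v : Fin N, ∑ σ : Fin N → Bool,
        hcWeight G β σ * (hcX G p u σ * hcX G p v σ)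
      ≤ (N + ∑ u : Fin N, (deg G u : ℝ)) * Z := by
    refine (sum_le_sum fun u _ => sum_le_sum fun v _ => h2 u v).trans (le_of_eq ?_)
    simp only [sum_add_distrib]
    rw [add_mul, sum_mul]
    congr 1
    · simp
    · refine sum_congr rfl fun u _ => ?_
      rw [← sum_filter, sum_const, nsmul_eq_mul, deg]
  rw [h1]
  have h4 : ∑ u : Fin N, (deg G u : ℝ) ≤ N * D := by
    have := mul_le_mul_of_nonneg_left hD hNpos.le
    rwa [← mul_assoc, mul_one_div_cancel hNpos.ne', one_mul] at this
  calc (1 / N : ℝ) ^ 2 * _ ≤ (1 / N : ℝ) ^ 2 * ((N + ∑ u : Fin N, (deg G u : ℝ)) * Z) :=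
        mul_le_mul_of_nonneg_left h3 (by positivity)
    _ ≤ (1 / N : ℝ) ^ 2 * ((N + N * D) * Z) := by gcongr
    _ = (1 + D) / N * Z := by field_simp
end
end

section
/- Fix q ≥ 2, β ∈ ℝ^{q−1}, a connected constraint graph H on {0,…,q−1} with H ≠ K_q^+, and D < ∞. There exists a constant C = C(β, q, D) < ∞ such that for every N ≥ 1 and every finite simple graph G on {1,…,N} with Ω_G(H) nonempty and (1/N)·Σ_{u=1}^N d_u(G) ≤ D, one has E_{σ∼P^N_β}[ ‖L_σ(β)‖₂² ] ≤ C/N. -/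
open Finset Filter

open scoped Classical

noncomputable section

/-- `σ` is an `H`-coloring of `G`: adjacent vertices of `G` receive adjacent colors
in the constraint graph `H` (given as a symmetric relation on `Fin q`, possibly with
self-loops). -/
def IsHColoring {q N : ℕ} (G : SimpleGraph (Fin N)) (H : Fin q → Fin q → Prop)
    (σ : Fin N → Fin q) : Prop :=
  ∀ u v : Fin N, G.Adj u v → H (σ u) (σ v)

/-- `c_s(σ)`: the number of vertices with color `s`. -/
def colCount {q N : ℕ} (s : Fin q) (σ : Fin N → Fin q) : ℕ :=
  (univ.filter fun u => σ u = s).card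

/-- The vertex `u` is `s`-feasible for `σ`: every neighbor of `u` in `G` has a color
in the `H`-neighborhood of `s`. -/
def feas {q N : ℕ} (G : SimpleGraph (Fin N)) (H : Fin q → Fin q → Prop)
    (σ : Fin N → Fin q) (u : Fin N) (s : Fin q) : Prop :=
  ∀ v : Fin N, G.Adj u v → H s (σ v)

/-- `u_r(σ)`: the number of `r`-feasible (i.e. `r`-unconstrained) vertices. -/
def uCount {q N : ℕ} (G : SimpleGraph (Fin N)) (H : Fin q → Fin q → Prop)
    (r : Fin q) (σ : Fin N → Fin q) : ℕ :=
  (univ.filter fun u => feas G H σ u r).card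

/-- Unnormalized weight of a configuration in the `H`-coloring model with activity
parameters `b` (with the convention `b 0 = 0`). -/
def hWeight {q N : ℕ} (G : SimpleGraph (Fin N)) (H : Fin q → Fin q → Prop)
    (b : Fin q → ℝ) (σ : Fin N → Fin q) : ℝ :=
  if IsHColoring G H σ then Real.exp (∑ s : Fin q, b s * colCount s σ) else 0

/-- Probability of the event `A` under the `H`-coloring model `P^N_b` on `G`. -/
def hProb {q N : ℕ} (G : SimpleGraph (Fin N)) (H : Fin q → Fin q → Prop)
    (b : Fin q → ℝ) (A : (Fin N → Fin q) → Prop) : ℝ :=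
  (∑ σ : Fin N → Fin q, if A σ then hWeight G H b σ else 0) /
    ∑ σ : Fin N → Fin q, hWeight G H b σ

/-- Expectation of `f` under the `H`-coloring model `P^N_b` on `G`. -/
def hExp {q N : ℕ} (G : SimpleGraph (Fin N)) (H : Fin q → Fin q → Prop)
    (b : Fin q → ℝ) (f : (Fin N → Fin q) → ℝ) : ℝ :=
  (∑ σ : Fin N → Fin q, hWeight G H b σ * f σ) /
    ∑ σ : Fin N → Fin q, hWeight G H b σ

/-- `L^{(r)}_σ(b)`: the `r`-th coordinate of (1/N times) the gradient of the log
pseudo-likelihood of the `H`-coloring model. -/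
def Lr {q N : ℕ} (G : SimpleGraph (Fin N)) (H : Fin q → Fin q → Prop)
    (σ : Fin N → Fin q) (b : Fin q → ℝ) (r : Fin q) : ℝ :=
  (colCount r σ : ℝ) / N - (1 / N : ℝ) * ∑ u : Fin N,
    Real.exp (b r) * (if feas G H σ u r then 1 else 0) /
      ∑ s : Fin q, Real.exp (b s) * (if feas G H σ u s then 1 else 0)

lemma aux_sum_zero {q N : ℕ} [NeZero q] (u : Fin N) (F : (Fin N → Fin q) → ℝ)
    (h : ∀ σ, ∑ s : Fin q, F (Function.update σ u s) = 0) : ∑ σ, F σ = 0 := by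
  rw [← (Equiv.funSplitAt u (Fin q)).symm.sum_comp F, Fintype.sum_prod_type_right]
  refine Finset.sum_eq_zero fun y _ => ?_
  rw [← h ((Equiv.funSplitAt u (Fin q)).symm (0, y))]
  refine Finset.sum_congr rfl fun s _ => ?_
  congr 1
  funext j
  by_cases hj : j = u
  · subst hj; simp [Equiv.funSplitAt, Equiv.piSplitAt]
  · simp [Equiv.funSplitAt, Equiv.piSplitAt, hj]

lemma aux_count {q N : ℕ} (b : Fin q → ℝ) (σ : Fin N → Fin q) :
    ∑ s : Fin q, b s * colCount s σ = ∑ v, b (σ v) := by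
  have : ∀ s, b s * (colCount s σ : ℝ) = ∑ v, if σ v = s then b s else 0 := by
    intro s
    rw [← Finset.sum_filter, Finset.sum_const, nsmul_eq_mul, mul_comm]; rfl
  simp_rw [this]
  rw [Finset.sum_comm]
  simp

lemma aux_feas {q N : ℕ} (G : SimpleGraph (Fin N)) (H : Fin q → Fin q → Prop)
    (σ : Fin N → Fin q) (u v : Fin N) (huv : ¬ G.Adj v u) (s t : Fin q) :
    feas G H (Function.update σ u s) v t ↔ feas G H σ v t := by
  unfold feas
  refine forall_congr' fun w => ?_
  by_cases hw : w = u
  · subst hw; simp [huv]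
  · simp [hw]

lemma aux_col {q N : ℕ} (G : SimpleGraph (Fin N)) (H : Fin q → Fin q → Prop)
    (hsym : ∀ s t : Fin q, H s t → H t s)
    (σ : Fin N → Fin q) (u : Fin N) (s : Fin q) :
    IsHColoring G H (Function.update σ u s) ↔ feas G H σ u s ∧
      ∀ v w, v ≠ u → w ≠ u → G.Adj v w → H (σ v) (σ w) := by
  constructor
  · intro h
    refine ⟨fun v hv => ?_, fun v w hv hw ha => ?_⟩
    · have := h u v hv
      simpa [hv.ne'] using this
    · simpa [hv, hw] using h v w ha
  · rintro ⟨h1, h2⟩ v w ha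
    by_cases hv : v = u
    · subst hv
      simpa [ha.ne'] using h1 w ha
    · by_cases hw : w = u
      · subst hw
        simpa [hv] using hsym _ _ (h1 v ha.symm)
      · simpa [hv, hw] using h2 v w hv hw ha

lemma aux_weight {q N : ℕ} (G : SimpleGraph (Fin N)) (H : Fin q → Fin q → Prop)
    (hsym : ∀ s t : Fin q, H s t → H t s) (b : Fin q → ℝ)
    (σ : Fin N → Fin q) (u : Fin N) : ∃ K : ℝ, ∀ s,
    hWeight G H b (Function.update σ u s) =
      K * (Real.exp (b s) * (if feas G H σ u s then 1 else 0)) := by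
  refine ⟨if (∀ v w, v ≠ u → w ≠ u → G.Adj v w → H (σ v) (σ w)) then
    Real.exp (∑ v ∈ univ.erase u, b (σ v)) else 0, fun s => ?_⟩
  have e : ∑ v, b (Function.update σ u s v) = (∑ v ∈ univ.erase u, b (σ v)) + b s := by
    rw [← Finset.sum_erase_add _ _ (Finset.mem_univ u)]
    congr 1
    · refine Finset.sum_congr rfl fun v hv => ?_
      rw [Function.update_of_ne (Finset.ne_of_mem_erase hv)]
    · simp
  unfold hWeight
  rw [aux_count, e, Real.exp_add, aux_col G H hsym]
  by_cases h1 : feas G H σ u s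
  · by_cases h2 : (∀ v w, v ≠ u → w ≠ u → G.Adj v w → H (σ v) (σ w))
    · rw [if_pos ⟨h1, h2⟩, if_pos h2, if_pos h1]; ring
    · rw [if_neg (fun h => h2 h.2), if_neg h2]; ring
  · rw [if_neg (fun h => h1 h.1), if_neg h1]; ring

/-- conditional probability of color `r` at `u`. -/
def auxP {q N : ℕ} (G : SimpleGraph (Fin N)) (H : Fin q → Fin q → Prop)
    (b : Fin q → ℝ) (r : Fin q) (u : Fin N) (σ : Fin N → Fin q) : ℝ :=
  Real.exp (b r) * (if feas G H σ u r then 1 else 0) /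
      ∑ s : Fin q, Real.exp (b s) * (if feas G H σ u s then 1 else 0)

/-- centered indicator. -/
def auxX {q N : ℕ} (G : SimpleGraph (Fin N)) (H : Fin q → Fin q → Prop)
    (b : Fin q → ℝ) (r : Fin q) (u : Fin N) (σ : Fin N → Fin q) : ℝ :=
  (if σ u = r then 1 else 0) - auxP G H b r u σ

lemma auxP_update {q N : ℕ} (G : SimpleGraph (Fin N)) (H : Fin q → Fin q → Prop)
    (b : Fin q → ℝ) (r : Fin q) (u v : Fin N) (huv : ¬ G.Adj v u) (σ : Fin N → Fin q)
    (s : Fin q) : auxP G H b r v (Function.update σ u s) = auxP G H b r v σ := by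
  unfold auxP
  simp only [aux_feas G H σ u v huv]

lemma auxX_abs {q N : ℕ} (G : SimpleGraph (Fin N)) (H : Fin q → Fin q → Prop)
    (b : Fin q → ℝ) (r : Fin q) (u : Fin N) (σ : Fin N → Fin q) :
    |auxX G H b r u σ| ≤ 1 := by
  have hnn : ∀ s : Fin q, 0 ≤ Real.exp (b s) * (if feas G H σ u s then (1:ℝ) else 0) := by
    intro s; split_ifs <;> positivity
  have h0 : 0 ≤ auxP G H b r u σ :=
    div_nonneg (hnn r) (Finset.sum_nonneg fun s _ => hnn s)
  have h1 : auxP G H b r u σ ≤ 1 :=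
    div_le_one_of_le₀ (Finset.single_le_sum (fun s _ => hnn s) (Finset.mem_univ r))
      (Finset.sum_nonneg fun s _ => hnn s)
  unfold auxX
  rw [abs_le]
  split_ifs <;> constructor <;> linarith

lemma aux_orth {q N : ℕ} [NeZero q] (G : SimpleGraph (Fin N)) (H : Fin q → Fin q → Prop)
    (hsym : ∀ s t : Fin q, H s t → H t s) (b : Fin q → ℝ) (r : Fin q)
    (u v : Fin N) (hne : v ≠ u) (huv : ¬ G.Adj v u) :
    ∑ σ, hWeight G H b σ * (auxX G H b r u σ * auxX G H b r v σ) = 0 := by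
  apply aux_sum_zero u
  intro σ
  obtain ⟨K, hK⟩ := aux_weight G H hsym b σ u
  have hv : ∀ s, auxX G H b r v (Function.update σ u s) = auxX G H b r v σ := by
    intro s
    unfold auxX
    rw [auxP_update G H b r u v huv, Function.update_of_ne hne]
  have hu : ∀ s, auxX G H b r u (Function.update σ u s)
      = (if s = r then 1 else 0) - auxP G H b r u σ := by
    intro s
    unfold auxX
    rw [auxP_update G H b r u u (G.irrefl), Function.update_self]
  simp_rw [hK, hv, hu]
  set a : Fin q → ℝ := fun s => Real.exp (b s) * (if feas G H σ u s then (1:ℝ) else 0) with ha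
  have hnn : ∀ s, 0 ≤ a s := by
    intro s; simp only [ha]; split_ifs <;> positivity
  have hP : (∑ s, a s) * auxP G H b r u σ = a r := by
    change (∑ s, a s) * (a r / ∑ s, a s) = a r
    by_cases hz : ∑ s, a s = 0
    · rw [hz, (Finset.sum_eq_zero_iff_of_nonneg fun s _ => hnn s).1 hz r (Finset.mem_univ r)]
      simp
    · field_simp
  have : ∀ s, K * a s * (((if s = r then 1 else 0) - auxP G H b r u σ) * auxX G H b r v σ)
      = K * auxX G H b r v σ * ((if s = r then a s else 0) - a s * auxP G H b r u σ) := by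
    intro s; split_ifs <;> ring
  rw [Finset.sum_congr rfl fun s _ => this s, ← Finset.mul_sum, Finset.sum_sub_distrib,
    ← Finset.sum_mul, hP]
  simp

lemma aux_Lr {q N : ℕ} (G : SimpleGraph (Fin N)) (H : Fin q → Fin q → Prop)
    (b : Fin q → ℝ) (r : Fin q) (σ : Fin N → Fin q) :
    Lr G H σ b r = (1 / N : ℝ) * ∑ u, auxX G H b r u σ := by
  unfold Lr auxX
  rw [Finset.sum_sub_distrib]
  have : (colCount r σ : ℝ) = ∑ u, if σ u = r then (1:ℝ) else 0 := by
    simp [colCount]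
  rw [this]
  unfold auxP
  ring

lemma aux_main {q N : ℕ} [NeZero q] (G : SimpleGraph (Fin N)) (H : Fin q → Fin q → Prop)
    (hsym : ∀ s t : Fin q, H s t → H t s) (b : Fin q → ℝ) (r : Fin q) :
    ∑ σ, hWeight G H b σ * (∑ u, auxX G H b r u σ) ^ 2
      ≤ (∑ σ, hWeight G H b σ) * (N + ∑ u, (deg G u : ℝ)) := by
  have hw : ∀ σ, 0 ≤ hWeight G H b σ := by
    intro σ; unfold hWeight; split_ifs <;> positivity
  have e : ∑ σ, hWeight G H b σ * (∑ u, auxX G H b r u σ) ^ 2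
      = ∑ u, ∑ v, ∑ σ, hWeight G H b σ * (auxX G H b r u σ * auxX G H b r v σ) := by
    simp_rw [sq, Finset.sum_mul_sum, Finset.mul_sum]
    rw [Finset.sum_comm]
    exact Finset.sum_congr rfl fun u _ => Finset.sum_comm
  have e2 : (∑ σ, hWeight G H b σ) * (N + ∑ u, (deg G u : ℝ)) =
      ∑ u : Fin N, ∑ v : Fin N, (∑ σ, hWeight G H b σ) *
        ((if u = v then 1 else 0) + (if G.Adj u v then 1 else 0)) := by
    simp_rw [← Finset.mul_sum, Finset.sum_add_distrib]
    simp [deg]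
  rw [e, e2]
  refine Finset.sum_le_sum fun u _ => Finset.sum_le_sum fun v _ => ?_
  have bd : ∑ σ, hWeight G H b σ * (auxX G H b r u σ * auxX G H b r v σ)
      ≤ ∑ σ, hWeight G H b σ := by
    refine Finset.sum_le_sum fun σ _ => ?_
    refine mul_le_of_le_one_right (hw σ) ?_
    refine (le_abs_self _).trans ?_
    rw [abs_mul]
    exact mul_le_one₀ (auxX_abs ..) (abs_nonneg _) (auxX_abs ..)
  have hZ := Finset.sum_nonneg fun σ (_ : σ ∈ univ) => hw σ
  by_cases h1 : u = v
  · rw [if_pos h1]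
    refine bd.trans (le_mul_of_one_le_right hZ ?_)
    split_ifs <;> norm_num
  · by_cases h2 : G.Adj u v
    · rw [if_neg h1, if_pos h2]; simpa using bd
    · rw [aux_orth G H hsym b r u v (Ne.symm h1) (fun h => h2 h.symm)]
      simp [h1, h2]

/-- second moment bound for the gradient of the log pseudo-likelihood
at the true parameter in the `H`-coloring model, uniform over graphs with nonempty
coloring space and average degree at most `D`. -/
theorem stmt10 (q : ℕ) [NeZero q] (hq : 2 ≤ q)
    (β : Fin q → ℝ) (hβ0 : β 0 = 0)
    (H : Fin q → Fin q → Prop) (hsym : ∀ s t : Fin q, H s t → H t s)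
    (hconn : (SimpleGraph.fromRel H).Connected)
    (hne : ∃ s t : Fin q, ¬ H s t)
    (D : ℝ) :
    ∃ C : ℝ, ∀ N : ℕ, 1 ≤ N → ∀ G : SimpleGraph (Fin N),
      (∃ σ : Fin N → Fin q, IsHColoring G H σ) →
      (1 / N : ℝ) * ∑ u : Fin N, (deg G u : ℝ) ≤ D →
      hExp G H β (fun σ => ∑ r ∈ univ.erase (0 : Fin q), (Lr G H σ β r) ^ 2) ≤ C / N := by
  refine ⟨q * (1 + D), fun N hN G ⟨σ₀, hσ₀⟩ hD => ?_⟩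
  have hNpos : (0:ℝ) < N := by exact_mod_cast hN
  have hw : ∀ σ, 0 ≤ hWeight G H β σ := by
    intro σ; unfold hWeight; split_ifs <;> positivity
  have hZ : 0 < ∑ σ, hWeight G H β σ := by
    refine Finset.sum_pos' (fun σ _ => hw σ) ⟨σ₀, Finset.mem_univ _, ?_⟩
    unfold hWeight; rw [if_pos hσ₀]; positivity
  have hS : ∑ u, (deg G u : ℝ) ≤ D * N := by
    rw [one_div, inv_mul_le_iff₀ hNpos] at hD; linarith
  have hS0 : 0 ≤ ∑ u, (deg G u : ℝ) := Finset.sum_nonneg fun _ _ => Nat.cast_nonneg _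
  have hD0 : 0 ≤ 1 + D := by
    have : 0 ≤ (1 / N : ℝ) * ∑ u : Fin N, (deg G u : ℝ) := by positivity
    linarith
  set Z := ∑ σ, hWeight G H β σ with hZdef
  have key : ∀ r, ∑ σ, hWeight G H β σ * (Lr G H σ β r) ^ 2 ≤ Z * ((1 + D) / N) := by
    intro r
    have h := aux_main G H hsym β r
    have e : ∑ σ, hWeight G H β σ * (Lr G H σ β r) ^ 2 =
        (1 / N : ℝ) ^ 2 * ∑ σ, hWeight G H β σ * (∑ u, auxX G H β r u σ) ^ 2 := by
      rw [Finset.mul_sum]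
      refine Finset.sum_congr rfl fun σ _ => ?_
      rw [aux_Lr]; ring
    rw [e]
    calc _ ≤ (1 / N : ℝ) ^ 2 * (Z * (N + ∑ u, (deg G u : ℝ))) := by gcongr
      _ ≤ (1 / N : ℝ) ^ 2 * (Z * (N + D * N)) := by gcongr
      _ = Z * ((1 + D) / N) := by field_simp
  unfold hExp
  rw [div_le_iff₀ hZ]
  calc ∑ σ, hWeight G H β σ * ∑ r ∈ univ.erase (0 : Fin q), (Lr G H σ β r) ^ 2
      = ∑ r ∈ univ.erase (0 : Fin q), ∑ σ, hWeight G H β σ * (Lr G H σ β r) ^ 2 := by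
        simp_rw [Finset.mul_sum]; rw [Finset.sum_comm]
    _ ≤ ∑ r : Fin q, ∑ σ, hWeight G H β σ * (Lr G H σ β r) ^ 2 :=
        Finset.sum_le_sum_of_subset_of_nonneg (Finset.erase_subset _ _)
          fun r _ _ => Finset.sum_nonneg fun σ _ => mul_nonneg (hw σ) (sq_nonneg _)
    _ ≤ ∑ r : Fin q, Z * ((1 + D) / N) := Finset.sum_le_sum fun r _ => key r
    _ = q * (1 + D) / N * Z := by simp; ring
end
end

section
/- Fix q ≥ 2, β ∈ ℝ^{q−1}, a connected constraint graph H on {0,…,q−1}, and r ∈ {1,…,q−1}. Let {G_N}_{N≥1} be finite simple graphs on {1,…,N} with Ω_{G_N}(H) nonempty and uniformly bounded maximum degree, i.e. sup_N max_{1≤u≤N} d_u(G_N) < ∞. For δ > 0 let β_{δ,r} := (β_1,…,β_{r−1}, β_r − δ, β_{r+1},…,β_{q−1}). If lim_{δ→0⁺} liminf_{N→∞} (1/N)·E_{σ∼P^N_{β_{δ,r}}}[c_r(σ)] > 0, then lim_{ε→0⁺} limsup_{N→∞} P^N_β(c_r(σ) ≤ εN) = 0; consequently lim_{ε→0⁺}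 liminf_{N→∞} P^N_β(u_r(σ) > εN) = 1. -/
open Finset Filter

open scoped Classical

noncomputable section

lemma aux_hWeight_nonneg {q N : ℕ} (G : SimpleGraph (Fin N)) (H : Fin q → Fin q → Prop)
    (b : Fin q → ℝ) (σ : Fin N → Fin q) : 0 ≤ hWeight G H b σ := by
  unfold hWeight
  split_ifs
  · exact (Real.exp_pos _).le
  · exact le_rfl

lemma aux_Z_pos {q N : ℕ} (G : SimpleGraph (Fin N)) (H : Fin q → Fin q → Prop)
    (b : Fin q → ℝ) (h : ∃ σ : Fin N → Fin q, IsHColoring G H σ) :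
    0 < ∑ σ : Fin N → Fin q, hWeight G H b σ := by
  obtain ⟨σ, hσ⟩ := h
  refine Finset.sum_pos' (fun τ _ => aux_hWeight_nonneg G H b τ) ⟨σ, Finset.mem_univ _, ?_⟩
  unfold hWeight
  rw [if_pos hσ]
  exact Real.exp_pos _

lemma aux_hWeight_update {q N : ℕ} (G : SimpleGraph (Fin N)) (H : Fin q → Fin q → Prop)
    (b : Fin q → ℝ) (r : Fin q) (δ : ℝ) (σ : Fin N → Fin q) :
    hWeight G H b σ =
      hWeight G H (Function.update b r (b r - δ)) σ * Real.exp (δ * colCount r σ) := by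
  unfold hWeight
  split_ifs
  · rw [← Real.exp_add]
    congr 1
    rw [← Finset.add_sum_erase _ _ (Finset.mem_univ r),
      ← Finset.add_sum_erase _ (fun s => Function.update b r (b r - δ) s * (colCount s σ : ℝ))
        (Finset.mem_univ r)]
    have : ∑ s ∈ Finset.univ.erase r, Function.update b r (b r - δ) s * (colCount s σ : ℝ)
        = ∑ s ∈ Finset.univ.erase r, b s * (colCount s σ : ℝ) := by
      refine Finset.sum_congr rfl fun s hs => ?_
      rw [Function.update_of_ne (Finset.ne_of_mem_erase hs)]
    rw [this, Function.update_self]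
    ring
  · simp

lemma aux_bound {q N : ℕ} (G : SimpleGraph (Fin N)) (H : Fin q → Fin q → Prop)
    (b : Fin q → ℝ) (h : ∃ σ : Fin N → Fin q, IsHColoring G H σ) (r : Fin q) (δ a : ℝ)
    (hδ : 0 < δ) :
    hProb G H b (fun σ => (colCount r σ : ℝ) ≤ a) ≤
      Real.exp (δ * a - δ * hExp G H (Function.update b r (b r - δ))
        (fun σ => (colCount r σ : ℝ))) := by
  set b' := Function.update b r (b r - δ) with hb'
  set m := hExp G H b' (fun σ => (colCount r σ : ℝ)) with hm
  have hZ := aux_Z_pos G H b h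
  have hZ' := aux_Z_pos G H b' h
  set Z' := ∑ σ : Fin N → Fin q, hWeight G H b' σ with hZ'd
  have hmz : ∑ σ : Fin N → Fin q, hWeight G H b' σ * (colCount r σ : ℝ) = m * Z' := by
    rw [hm, hExp, div_mul_cancel₀ _ hZ'.ne']
  have h1 : Real.exp (δ * m) * Z' ≤ ∑ σ : Fin N → Fin q, hWeight G H b σ := by
    have h2 : ∀ σ : Fin N → Fin q,
        Real.exp (δ * m) * (hWeight G H b' σ * (1 - δ * m)
          + δ * (hWeight G H b' σ * (colCount r σ : ℝ))) ≤ hWeight G H b σ := by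
      intro σ
      rw [aux_hWeight_update G H b r δ σ, ← hb']
      have h3 : Real.exp (δ * colCount r σ) =
          Real.exp (δ * m) * Real.exp (δ * colCount r σ - δ * m) := by
        rw [← Real.exp_add]; congr 1; ring
      rw [h3]
      have h4 := Real.add_one_le_exp (δ * colCount r σ - δ * m)
      have h5 := aux_hWeight_nonneg G H b' σ
      have h6 := mul_le_mul_of_nonneg_left h4 (mul_nonneg (Real.exp_pos (δ * m)).le h5)
      linarith
    have h7 := Finset.sum_le_sum (fun σ (_ : σ ∈ Finset.univ) => h2 σ)
    rw [← Finset.mul_sum, Finset.sum_add_distrib, ← Finset.sum_mul, ← Finset.mul_sum, hmz,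
      ← hZ'd] at h7
    calc _ = _ := by ring
      _ ≤ _ := h7
  have h8 : (∑ σ : Fin N → Fin q, if (colCount r σ : ℝ) ≤ a then hWeight G H b σ else 0)
      ≤ Real.exp (δ * a) * Z' := by
    rw [hZ'd, Finset.mul_sum]
    refine Finset.sum_le_sum fun σ _ => ?_
    have h5 := aux_hWeight_nonneg G H b' σ
    split_ifs with hc
    · rw [aux_hWeight_update G H b r δ σ, ← hb', mul_comm]
      gcongr
    · positivity
  unfold hProb
  rw [div_le_iff₀ hZ]
  calc _ ≤ _ := h8
    _ = Real.exp (δ * a - δ * m) * (Real.exp (δ * m) * Z') := by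
      rw [← mul_assoc, ← Real.exp_add]; congr 2; ring
    _ ≤ _ := by gcongr

lemma aux_hProb_nonneg {q N : ℕ} (G : SimpleGraph (Fin N)) (H : Fin q → Fin q → Prop)
    (b : Fin q → ℝ) (A : (Fin N → Fin q) → Prop) : 0 ≤ hProb G H b A := by
  unfold hProb
  refine div_nonneg (Finset.sum_nonneg fun σ _ => ?_)
    (Finset.sum_nonneg fun σ _ => aux_hWeight_nonneg G H b σ)
  split_ifs
  · exact aux_hWeight_nonneg G H b σ
  · exact le_rfl

lemma aux_hProb_le_one {q N : ℕ} (G : SimpleGraph (Fin N)) (H : Fin q → Fin q → Prop)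
    (b : Fin q → ℝ) (A : (Fin N → Fin q) → Prop) : hProb G H b A ≤ 1 := by
  unfold hProb
  refine div_le_one_of_le₀ (Finset.sum_le_sum fun σ _ => ?_)
    (Finset.sum_nonneg fun σ _ => aux_hWeight_nonneg G H b σ)
  split_ifs
  · exact le_rfl
  · exact aux_hWeight_nonneg G H b σ

lemma aux_compl {q N : ℕ} (G : SimpleGraph (Fin N)) (H : Fin q → Fin q → Prop)
    (b : Fin q → ℝ) (h : ∃ σ : Fin N → Fin q, IsHColoring G H σ) (r : Fin q) (a : ℝ) :
    1 - hProb G H b (fun σ => (colCount r σ : ℝ) ≤ a) ≤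
      hProb G H b (fun σ => a < (uCount G H r σ : ℝ)) := by
  have hZ := aux_Z_pos G H b h
  rw [sub_le_iff_le_add]
  unfold hProb
  rw [← add_div, le_div_iff₀ hZ, one_mul, ← Finset.sum_add_distrib]
  refine Finset.sum_le_sum fun σ _ => ?_
  have h5 := aux_hWeight_nonneg G H b σ
  by_cases hσ : IsHColoring G H σ
  · have hle : (colCount r σ : ℝ) ≤ uCount G H r σ := by
      unfold colCount uCount
      refine Nat.cast_le.2 (Finset.card_le_card fun u hu => ?_)
      simp only [Finset.mem_filter, Finset.mem_univ, true_and] at hu ⊢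
      intro v hv
      have := hσ u v hv
      rwa [hu] at this
    by_cases hc : (colCount r σ : ℝ) ≤ a
    · rw [if_pos hc]
      split_ifs <;> linarith
    · rw [if_neg hc, if_pos (lt_of_lt_of_le (not_le.1 hc) hle), add_zero]
  · have : hWeight G H b σ = 0 := by unfold hWeight; rw [if_neg hσ]
    simp [this]

/-- for `H`-coloring models on graph sequences with uniformly bounded
maximum degree, if the expected fraction of vertices of color `r` stays positive under
the slightly perturbed parameters `β_{δ,r}` as `δ → 0⁺`, then the fraction of vertices
of color `r` is `Θ(N)` with high probability, and the rainbow condition holds for `r`. -/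
theorem stmt13 (q : ℕ) [NeZero q] (hq : 2 ≤ q)
    (β : Fin q → ℝ) (hβ0 : β 0 = 0)
    (H : Fin q → Fin q → Prop) (hsym : ∀ s t : Fin q, H s t → H t s)
    (hconn : (SimpleGraph.fromRel H).Connected)
    (r : Fin q) (hr : r ≠ 0)
    (G : ∀ N : ℕ, SimpleGraph (Fin N))
    (hnonempty : ∀ N : ℕ, ∃ σ : Fin N → Fin q, IsHColoring (G N) H σ)
    (hdeg : ∃ D : ℝ, ∀ N : ℕ, ∀ u : Fin N, (deg (G N) u : ℝ) ≤ D)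
    (hexp : ∃ L : ℝ, 0 < L ∧
      Tendsto (fun δ : ℝ =>
          liminf (fun N : ℕ =>
              (1 / N : ℝ) * hExp (G N) H (Function.update β r (β r - δ))
                (fun σ => (colCount r σ : ℝ))) atTop)
        (nhdsWithin 0 (Set.Ioi 0)) (nhds L)) :
    Tendsto (fun ε : ℝ =>
        limsup (fun N : ℕ =>
            hProb (G N) H β (fun σ => (colCount r σ : ℝ) ≤ ε * N)) atTop)
      (nhdsWithin 0 (Set.Ioi 0)) (nhds 0) ∧
    Tendsto (fun ε : ℝ =>
        liminf (fun N : ℕ =>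
            hProb (G N) H β (fun σ => ε * N < (uCount (G N) H r σ : ℝ))) atTop)
      (nhdsWithin 0 (Set.Ioi 0)) (nhds 1) := by
  obtain ⟨L, hL, hT⟩ := hexp
  have hev := (hT.eventually (lt_mem_nhds (half_lt_self hL))).and self_mem_nhdsWithin
  obtain ⟨δ, hδL, hδ⟩ := hev.exists
  have hδ : 0 < δ := hδ
  have hE : ∀ᶠ N : ℕ in atTop, L / 2 < (1 / N : ℝ) * hExp (G N) H
      (Function.update β r (β r - δ)) (fun σ => (colCount r σ : ℝ)) := by
    refine eventually_lt_of_lt_liminf hδL ⟨0, Filter.eventually_map.2 (Eventually.of_forall fun N => ?_)⟩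
    refine mul_nonneg (by positivity) (div_nonneg (Finset.sum_nonneg fun σ _ => ?_)
      (Finset.sum_nonneg fun σ _ => aux_hWeight_nonneg _ H _ σ))
    exact mul_nonneg (aux_hWeight_nonneg _ H _ σ) (Nat.cast_nonneg _)
  have key : ∀ ε : ℝ, ε < L / 4 → Tendsto (fun N : ℕ =>
      hProb (G N) H β (fun σ => (colCount r σ : ℝ) ≤ ε * N)) atTop (nhds 0) := by
    intro ε hε
    have hlim : Tendsto (fun N : ℕ => Real.exp (-(δ * (L / 4) * N))) atTop (nhds 0) :=
      Real.tendsto_exp_neg_atTop_nhds_zero.comp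
        (Tendsto.const_mul_atTop (by positivity) tendsto_natCast_atTop_atTop)
    refine squeeze_zero' (Eventually.of_forall fun N => aux_hProb_nonneg _ _ _ _) ?_ hlim
    filter_upwards [hE, eventually_gt_atTop 0] with N hN hN0
    refine (aux_bound (G N) H β (hnonempty N) r δ (ε * N) hδ).trans (Real.exp_le_exp.2 ?_)
    have hNp : (0 : ℝ) < N := by exact_mod_cast hN0
    rw [one_div, inv_mul_eq_div, lt_div_iff₀ hNp] at hN
    have h1 : ε * N ≤ L / 4 * N := by gcongr
    have h2 := mul_le_mul_of_nonneg_left h1 hδ.le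
    have h3 := mul_le_mul_of_nonneg_left hN.le hδ.le
    linarith
  have hsmall : ∀ᶠ ε : ℝ in nhdsWithin 0 (Set.Ioi 0), ε < L / 4 :=
    nhdsWithin_le_nhds (gt_mem_nhds (by positivity))
  constructor
  · refine Tendsto.congr' ?_ tendsto_const_nhds
    filter_upwards [hsmall] with ε hε
    exact (key ε hε).limsup_eq.symm
  · refine Tendsto.congr' ?_ tendsto_const_nhds
    filter_upwards [hsmall] with ε hε
    have h1 : Tendsto (fun N : ℕ => 1 - hProb (G N) H β
        (fun σ => (colCount r σ : ℝ) ≤ ε * N)) atTop (nhds 1) := by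
      simpa using (key ε hε).const_sub 1
    exact (tendsto_of_tendsto_of_tendsto_of_le_of_le h1 tendsto_const_nhds
      (fun N => aux_compl (G N) H β (hnonempty N) r (ε * N))
      (fun N => aux_hProb_le_one _ _ _ _)).liminf_eq.symm
end
end

section
/- Let G be a finite simple graph on vertex set {1,…,N} and let W ⊆ V(G) with |W| ≥ N/2. Then there exists a subset A ⊆ W that is neighborhood disjoint in G (i.e. N_G(v) ∩ N_G(w) = ∅ for all distinct v, w ∈ A) with |A| ≥ |W|² / (|W| + Σ_{v∈W} d_{2,v}(G)); consequently |A| ≥ N / (4·(1 + (1/N)·Σ_{v∈V(G)} d_{2,v}(G))). -/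
open Finset

open scoped Classical

noncomputable section

/-- `d_{2,v}(G)`: the number of vertices at distance 1 or 2 from `v` in `G`. -/
def d2 {N : ℕ} (G : SimpleGraph (Fin N)) (v : Fin N) : ℕ :=
  (univ.filter fun w => G.dist v w = 1 ∨ G.dist v w = 2).card

theorem caro_wei {V : Type*} (H : SimpleGraph V) (n : ℕ) : ∀ W : Finset V, W.card = n →
    ∃ A ⊆ W, (∀ v ∈ A, ∀ w ∈ A, ¬ H.Adj v w) ∧
      ∑ v ∈ W, (1 : ℝ) / (1 + ((W.filter fun w => H.Adj v w).card : ℝ)) ≤ (A.card : ℝ) := by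
  induction n using Nat.strong_induction_on with
  | _ n ih =>
    intro W hn
    rcases W.eq_empty_or_nonempty with rfl | hne
    · exact ⟨∅, by simp, by simp, by simp⟩
    obtain ⟨v, hv, hmin⟩ := W.exists_min_image (fun v => (W.filter fun w => H.Adj v w).card) hne
    set C := insert v (W.filter fun w => H.Adj v w) with hC
    have hCW : C ⊆ W := by
      intro x hx
      simp only [hC, mem_insert, mem_filter] at hx
      rcases hx with rfl | hx
      · exact hv
      · exact hx.1
    have hvC : v ∈ C := by simp [hC]
    have hCcard : C.card = (W.filter fun w => H.Adj v w).card + 1 := by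
      rw [hC, card_insert_of_notMem (by simp)]
    have hlt : (W \ C).card < n := by
      rw [← hn]
      exact card_lt_card (Finset.ssubset_iff_subset_ne.2 ⟨sdiff_subset, fun h => by
        rw [← h] at hv
        exact (mem_sdiff.1 hv).2 hvC⟩)
    obtain ⟨A, hA, hind, hcard⟩ := ih _ hlt (W \ C) rfl
    have hvA : v ∉ A := fun h => (mem_sdiff.1 (hA h)).2 hvC
    have hnv : ∀ w ∈ A, ¬ H.Adj v w := by
      intro w hw h
      have h1 := mem_sdiff.1 (hA hw)
      exact h1.2 (by simp [hC, h, h1.1])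
    refine ⟨insert v A, ?_, ?_, ?_⟩
    · exact insert_subset hv (hA.trans sdiff_subset)
    · intro a ha b hb
      rcases mem_insert.1 ha with rfl | ha' <;> rcases mem_insert.1 hb with rfl | hb'
      · exact H.loopless.irrefl _
      · exact hnv _ hb'
      · exact fun h => hnv _ ha' h.symm
      · exact hind _ ha' _ hb'
    · rw [card_insert_of_notMem hvA, ← sum_sdiff hCW]
      push_cast
      refine add_le_add (le_trans (sum_le_sum fun x _ => ?_) hcard) ?_
      · have : (((W \ C).filter fun w => H.Adj x w).card : ℝ)
            ≤ ((W.filter fun w => H.Adj x w).card : ℝ) := by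
          exact_mod_cast card_le_card (filter_subset_filter _ sdiff_subset)
        gcongr
      · have h1 : ∀ x ∈ C, (1 : ℝ) / (1 + ((W.filter fun w => H.Adj x w).card : ℝ))
            ≤ 1 / (C.card : ℝ) := by
          intro x hx
          have h2 : ((W.filter fun w => H.Adj v w).card : ℝ)
            ≤ ((W.filter fun w => H.Adj x w).card : ℝ) := by
            exact_mod_cast hmin x (hCW hx)
          rw [hCcard]
          push_cast
          apply one_div_le_one_div_of_le <;> first | positivity | linarith
        refine (sum_le_sum h1).trans ?_
        have : (C.card : ℝ) ≠ 0 := by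
          rw [hCcard]; positivity
        simp [this]

theorem stmt17 {N : ℕ} (G : SimpleGraph (Fin N)) (W : Finset (Fin N))
    (hW : (N : ℝ) / 2 ≤ (W.card : ℝ)) :
    ∃ A ⊆ W,
      (∀ v ∈ A, ∀ w ∈ A, v ≠ w → ∀ x : Fin N, ¬(G.Adj v x ∧ G.Adj w x)) ∧
      (W.card : ℝ) ^ 2 / ((W.card : ℝ) + ∑ v ∈ W, (d2 G v : ℝ)) ≤ (A.card : ℝ) ∧
      (N : ℝ) / (4 * (1 + (1 / N : ℝ) * ∑ v : Fin N, (d2 G v : ℝ))) ≤ (A.card : ℝ) := by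
  obtain ⟨H, hH⟩ : ∃ H : SimpleGraph (Fin N), ∀ v w, H.Adj v w ↔
      (v ≠ w ∧ ∃ x, G.Adj v x ∧ G.Adj w x) := ⟨
    { Adj := fun v w => v ≠ w ∧ ∃ x, G.Adj v x ∧ G.Adj w x
      symm := ⟨fun v w h => ⟨h.1.symm, h.2.imp fun x hx => hx.symm⟩⟩
      loopless := ⟨fun v h => h.1 rfl⟩ }, fun _ _ => Iff.rfl⟩
  obtain ⟨A, hA, hind, hcard⟩ := caro_wei H _ W rfl
  have hdeg : ∀ v, (W.filter fun w => H.Adj v w).card ≤ d2 G v := by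
    intro v
    refine card_le_card ?_
    intro w hw
    obtain ⟨hne, x, hvx, hwx⟩ := (hH _ _).1 (mem_filter.1 hw).2
    have h2 : G.dist v w ≤ 2 :=
      G.dist_le (SimpleGraph.Walk.cons hvx (SimpleGraph.Walk.cons hwx.symm .nil))
    have hr : G.Reachable v w := hvx.reachable.trans hwx.symm.reachable
    have h0 := hr.pos_dist_of_ne hne
    simp only [mem_filter, mem_univ, true_and]
    omega
  have key : (W.card : ℝ) ^ 2 / ((W.card : ℝ) + ∑ v ∈ W, (d2 G v : ℝ)) ≤ (A.card : ℝ) := by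
    have hs := Finset.sq_sum_div_le_sum_sq_div W (fun _ => (1 : ℝ))
      (g := fun v => 1 + (d2 G v : ℝ)) (fun i _ => by positivity)
    simp only [sum_add_distrib, sum_const, nsmul_eq_mul, mul_one, one_pow] at hs
    refine hs.trans (le_trans (sum_le_sum fun v _ => ?_) hcard)
    have : ((W.filter fun w => H.Adj v w).card : ℝ) ≤ d2 G v := by exact_mod_cast hdeg v
    exact one_div_le_one_div_of_le (by positivity) (by linarith)
  refine ⟨A, hA, ?_, key, le_trans ?_ key⟩
  · intro v hv w hw hne x hx
    exact hind v hv w hw ((hH _ _).2 ⟨hne, x, hx⟩)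
  · rcases Nat.eq_zero_or_pos N with h0 | h0
    · subst h0
      simp only [Nat.cast_zero, zero_div]
      positivity
    have hN : (0 : ℝ) < N := by exact_mod_cast h0
    have hS : ∑ v ∈ W, (d2 G v : ℝ) ≤ ∑ v : Fin N, (d2 G v : ℝ) :=
      sum_le_sum_of_subset_of_nonneg (subset_univ _) fun _ _ _ => by positivity
    have hWN : (W.card : ℝ) ≤ N := by
      have := card_le_univ W
      rw [Fintype.card_fin] at this
      exact_mod_cast this
    have hS0 : 0 ≤ ∑ v ∈ W, (d2 G v : ℝ) := sum_nonneg fun _ _ => by positivity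
    have heq : (N : ℝ) / (4 * (1 + (1 / N : ℝ) * ∑ v : Fin N, (d2 G v : ℝ)))
        = ((N : ℝ) / 2) ^ 2 / (N + ∑ v : Fin N, (d2 G v : ℝ)) := by
      have : (N : ℝ) + ∑ v : Fin N, (d2 G v : ℝ) ≠ 0 := by positivity
      have h' : 1 + (1 / N : ℝ) * ∑ v : Fin N, (d2 G v : ℝ) ≠ 0 := by positivity
      field_simp
      ring
    rw [heq]
    have : 0 < (W.card : ℝ) + ∑ v ∈ W, (d2 G v : ℝ) := by linarith
    gcongr
end
end

section
/- Fix q ≥ 2. Let G be a finite simple graph on vertex set {1,…,N}, let σ be a proper q-coloring of G (adjacent vertices receive distinct colors from {0,…,q−1}), and let r ∈ {0,…,q−1}. Set S := (1/N)·Σ_{v=1}^N d_{2,v}(G), where d_{2,v}(G) is the number of vertices at distance 1 or 2 from v in G. Then the number of r-unconstrained vertices satisfies |{u ∈ {1,…,N} : σ_v ≠ r for every neighbor v of u in G}| ≥ N / (4·(1 + S)). -/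
open Finset

open scoped Classical

noncomputable section

/-- Two distinct vertices, each equal or adjacent to `c`, are at distance 1 or 2. -/
theorem dist_one_or_two {N : ℕ} (G : SimpleGraph (Fin N)) (v w c : Fin N)
    (hv : c = v ∨ G.Adj v c) (hw : c = w ∨ G.Adj w c) (hne : w ≠ v) :
    G.dist v w = 1 ∨ G.dist v w = 2 := by
  have key : ∃ p : G.Walk v w, p.length ≤ 2 := by
    rcases hv with rfl | hv
    · rcases hw with rfl | hw
      · exact absurd rfl hne
      · exact ⟨hw.symm.toWalk, by simp⟩
    · rcases hw with rfl | hw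
      · exact ⟨hv.toWalk, by simp⟩
      · exact ⟨SimpleGraph.Walk.cons hv hw.symm.toWalk, by simp⟩
  obtain ⟨p, hp⟩ := key
  have h1 := SimpleGraph.dist_le p
  have h2 : 0 < G.dist v w := SimpleGraph.Reachable.pos_dist_of_ne ⟨p⟩ hne.symm
  omega

/-- in any proper `q`-coloring `σ` of `G`, the number of
`r`-unconstrained vertices (vertices none of whose neighbors has color `r`) is at
least `N/(4(1+S))`, where `S = (1/N)·Σ_v d_{2,v}(G)`. -/
theorem stmt18 (q : ℕ) (hq : 2 ≤ q) {N : ℕ} (G : SimpleGraph (Fin N))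
    (σ : Fin N → Fin q) (hσ : ∀ u v : Fin N, G.Adj u v → σ u ≠ σ v) (r : Fin q) :
    (N : ℝ) / (4 * (1 + (1 / N : ℝ) * ∑ v : Fin N, (d2 G v : ℝ)))
      ≤ ((univ.filter fun u : Fin N => ∀ v : Fin N, G.Adj u v → σ v ≠ r).card : ℝ) := by
  set U := univ.filter fun u : Fin N => ∀ v : Fin N, G.Adj u v → σ v ≠ r with hU
  have hex : ∀ v : Fin N, ∃ c, c ∈ U ∧ (c = v ∨ G.Adj v c) := by
    intro v
    by_cases hv : v ∈ U
    · exact ⟨v, hv, Or.inl rfl⟩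
    · simp only [hU, mem_filter, mem_univ, true_and] at hv
      push Not at hv
      obtain ⟨c, hc, hr⟩ := hv
      refine ⟨c, ?_, Or.inr hc⟩
      simp only [hU, mem_filter, mem_univ, true_and]
      intro w hw h
      exact hσ c w hw (hr.trans h.symm)
  choose f hfU hf using hex
  have hfib : ∀ v : Fin N, (univ.filter fun w => f w = f v).card ≤ 1 + d2 G v := by
    intro v
    have hsub : (univ.filter fun w => f w = f v) ⊆
        insert v (univ.filter fun w => G.dist v w = 1 ∨ G.dist v w = 2) := by
      intro w hw
      simp only [mem_filter, mem_univ, true_and] at hw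
      simp only [mem_insert, mem_filter, mem_univ, true_and]
      by_cases h : w = v
      · exact Or.inl h
      · exact Or.inr (dist_one_or_two G v w (f v) (hf v) (hw ▸ hf w) h)
    have h1 := card_le_card hsub
    have h2 := card_insert_le v (univ.filter fun w => G.dist v w = 1 ∨ G.dist v w = 2)
    unfold d2
    omega
  have hcard : ∑ u ∈ U, (univ.filter fun w => f w = u).card = N := by
    rw [← card_eq_sum_card_fiberwise (fun v _ => hfU v)]
    simp
  have hsq : ∑ u ∈ U, (univ.filter fun w => f w = u).card ^ 2 ≤ ∑ v, (1 + d2 G v) := by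
    calc ∑ u ∈ U, (univ.filter fun w => f w = u).card ^ 2
        = ∑ u ∈ U, ∑ v ∈ univ.filter (fun w => f w = u),
            (univ.filter fun w => f w = f v).card := by
          refine sum_congr rfl fun u _ => ?_
          rw [sq, ← smul_eq_mul, ← sum_const]
          refine sum_congr rfl fun v hv => ?_
          rw [(mem_filter.mp hv).2]
      _ = ∑ v, (univ.filter fun w => f w = f v).card :=
          sum_fiberwise_of_maps_to (fun v _ => hfU v) _
      _ ≤ _ := sum_le_sum fun v _ => hfib v
  have hcs := sq_sum_le_card_mul_sum_sq (s := U)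
    (f := fun u => (univ.filter fun w => f w = u).card)
  rw [hcard] at hcs
  have hmain : N ^ 2 ≤ U.card * ∑ v, (1 + d2 G v) := hcs.trans (Nat.mul_le_mul_left _ hsq)
  have hmain' : (N : ℝ) ^ 2 ≤ U.card * (N + ∑ v, (d2 G v : ℝ)) := by
    have h : ((N ^ 2 : ℕ) : ℝ) ≤ ((U.card * ∑ v, (1 + d2 G v) : ℕ) : ℝ) := by
      exact_mod_cast hmain
    simpa [sum_add_distrib] using h
  have hT : 0 ≤ ∑ v, (d2 G v : ℝ) := sum_nonneg fun v _ => Nat.cast_nonneg _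
  generalize ∑ v, (d2 G v : ℝ) = T at hT hmain' ⊢
  have hUc : (0 : ℝ) ≤ U.card := Nat.cast_nonneg _
  rcases Nat.eq_zero_or_pos N with h0 | hN
  · have h0' : (N : ℝ) = 0 := by exact_mod_cast h0
    rw [h0', zero_div]
    exact hUc
  have hN' : (0 : ℝ) < N := by exact_mod_cast hN
  have hS : 0 ≤ 1 / (N : ℝ) * T := by positivity
  rw [div_le_iff₀ (by positivity)]
  have hle : (N : ℝ) ≤ U.card * (1 + 1 / (N : ℝ) * T) := by
    have he : (U.card : ℝ) * (1 + 1 / (N : ℝ) * T) = U.card * (N + T) / N := by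
      field_simp
    rw [he, le_div_iff₀ hN', ← sq]
    exact hmain'
  have : 0 ≤ (U.card : ℝ) * (1 + 1 / (N : ℝ) * T) := by positivity
  linarith
end
end
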